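/- arXiv:1503.08426 — 3 statements merged into one kernel-verified Lean document; each statement's English description precedes it below -/
import Mathlib

section
/- Let E = ℝⁿ with its standard inner product ⟪·,·⟫, let L ⊆ E be a ℤ-lattice (a discrete additive subgroup spanning E over ℝ) with dual lattice L* := { μ ∈ E : ⟪μ, λ⟫ ∈ ℤ for all λ ∈ L }, and let B : E → E be a skew-symmetric linear map (⟪Bx, y⟫ = -⟪x, By⟫ for all x,y). For λ, λ' ∈ L and μ, μ' ∈ L*, set γ := (1/√2)(μ - Bλ + λ, μ - Bλ - λ) and γ' := (1/√2)(μ' - Bλ' + λ', μ' - Bλ' - λ'). Then Q(γ, γ') = ⟪μ, λ'⟫ + ⟪μ', λ⟫; in particular Q(γ, γ') ∈ ℤ. -/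
open scoped RealInnerProductSpace

theorem inner_smul_add_sub_inner_smul_sub {E : Type*} [NormedAddCommGroup E]
    [InnerProductSpace ℝ E] (c : ℝ) (x y x' y' : E) :
    ⟪c • (x + y), c • (x' + y')⟫ - ⟪c • (x - y), c • (x' - y')⟫ =
      2 * c ^ 2 * (⟪x, y'⟫ + ⟪y, x'⟫) := by
  simp only [real_inner_smul_left, real_inner_smul_right, inner_add_left, inner_add_right,
    inner_sub_left, inner_sub_right]
  ring

/-- Integrality of the form `Q` on the charge lattice of a toroidal SCFT: for
`λ, λ' ∈ L`, `μ, μ' ∈ L*` and the corresponding charge vectors `γ, γ'`, one has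
`Q(γ, γ') = ⟪μ, λ'⟫ + ⟪μ', λ⟫ ∈ ℤ`. -/
theorem charge_lattice_integral {n : ℕ}
    (L : AddSubgroup (EuclideanSpace ℝ (Fin n)))
    (hdisc : DiscreteTopology L)
    (hspan : Submodule.span ℝ (L : Set (EuclideanSpace ℝ (Fin n))) = ⊤)
    (B : EuclideanSpace ℝ (Fin n) →ₗ[ℝ] EuclideanSpace ℝ (Fin n))
    (hB : ∀ x y : EuclideanSpace ℝ (Fin n), ⟪B x, y⟫ = -⟪x, B y⟫)
    (lam lam' : EuclideanSpace ℝ (Fin n)) (hlam : lam ∈ L) (hlam' : lam' ∈ L)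
    (mu mu' : EuclideanSpace ℝ (Fin n))
    (hmu : ∀ l ∈ L, ∃ m : ℤ, ⟪mu, l⟫ = (m : ℝ))
    (hmu' : ∀ l ∈ L, ∃ m : ℤ, ⟪mu', l⟫ = (m : ℝ))
    (γ γ' : EuclideanSpace ℝ (Fin n) × EuclideanSpace ℝ (Fin n))
    (hγ : γ = ((Real.sqrt 2)⁻¹ • (mu - B lam + lam),
               (Real.sqrt 2)⁻¹ • (mu - B lam - lam)))
    (hγ' : γ' = ((Real.sqrt 2)⁻¹ • (mu' - B lam' + lam'),
                 (Real.sqrt 2)⁻¹ • (mu' - B lam' - lam'))) :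
    ⟪γ.1, γ'.1⟫ - ⟪γ.2, γ'.2⟫ = ⟪mu, lam'⟫ + ⟪mu', lam⟫ ∧
      ∃ m : ℤ, ⟪γ.1, γ'.1⟫ - ⟪γ.2, γ'.2⟫ = (m : ℝ) := by
  have hQ : ⟪γ.1, γ'.1⟫ - ⟪γ.2, γ'.2⟫ = ⟪mu, lam'⟫ + ⟪mu', lam⟫ := by
    rw [hγ, hγ', inner_smul_add_sub_inner_smul_sub, inv_pow, Real.sq_sqrt zero_le_two,
      inner_sub_left, inner_sub_right, hB, real_inner_comm mu' lam]
    ring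
  obtain ⟨a, ha⟩ := hmu lam' hlam'
  obtain ⟨b, hb⟩ := hmu' lam hlam
  exact ⟨hQ, a + b, by rw [hQ, ha, hb, Int.cast_add]⟩
end

section
/- Let E = ℝⁿ with its standard inner product ⟪·,·⟫, let L ⊆ E be a ℤ-lattice (a discrete additive subgroup spanning E over ℝ) with dual lattice L* := { μ ∈ E : ⟪μ, λ⟫ ∈ ℤ for all λ ∈ L }, let B : E → E be a skew-symmetric linear map, and let Γ := { (1/√2)(μ - Bλ + λ, μ - Bλ - λ) : λ ∈ L, μ ∈ L* } ⊆ E × E. Then Γ is selfdual with respect to Q: the set { v ∈ E × E : Q(v, γ) ∈ ℤ for all γ ∈ Γ } equals Γ. -/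
open scoped RealInnerProductSpace

/-- A full lattice in a finite-dimensional real inner product space contains its double dual. -/
theorem mem_of_forall_dual_inner_mem_int {E : Type*} [NormedAddCommGroup E]
    [InnerProductSpace ℝ E] [FiniteDimensional ℝ E] (L : AddSubgroup E) (hdisc : DiscreteTopology L)
    (hspan : Submodule.span ℝ (L : Set E) = ⊤) {x : E}
    (hx : ∀ mu : E, (∀ l ∈ L, ∃ m : ℤ, ⟪mu, l⟫ = (m : ℝ)) → ∃ m : ℤ, ⟪x, mu⟫ = (m : ℝ)) :
    x ∈ L := by
  let M : Submodule ℤ E := AddSubgroup.toIntSubmodule L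
  have : DiscreteTopology M := hdisc
  have : IsZLattice ℝ M := ⟨hspan⟩
  have : Module.Finite ℤ M := ZLattice.module_finite ℝ M
  have : Module.Free ℤ M := ZLattice.module_free ℝ M
  let b := (Module.Free.chooseBasis ℤ M).ofZLatticeBasis ℝ M
  have hb : Submodule.span ℤ (Set.range b) = M := Module.Basis.ofZLatticeBasis_span ℝ M _
  have hsymm : LinearMap.BilinForm.IsSymm (innerₗ E) := ⟨fun y z => real_inner_comm z y⟩
  have hnd : (innerₗ E).Nondegenerate :=
    ⟨fun y hy => inner_self_eq_zero.mp (hy y), fun y hy => inner_self_eq_zero.mp (hy y)⟩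
  have hdd := LinearMap.BilinForm.dualSubmodule_dualSubmodule_of_basis (R := ℤ) (innerₗ E) hnd hsymm b
  rw [hb] at hdd
  change x ∈ M
  rw [← hdd]
  intro mu hmu
  obtain ⟨m, hm⟩ := hx mu fun l hl => by
    obtain ⟨m, hm⟩ := Submodule.mem_one.mp (hmu l hl)
    exact ⟨m, hm.symm⟩
  exact Submodule.mem_one.mpr ⟨m, hm.symm⟩

/-- In light-cone coordinates, the form `⟪a, a'⟫ - ⟪b, b'⟫` is hyperbolic. -/
theorem inner_sub_inner_sqrt_two_smul {E : Type*} [NormedAddCommGroup E] [InnerProductSpace ℝ E]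
    (a b p q : E) :
    ⟪a, (Real.sqrt 2)⁻¹ • (p + q)⟫ - ⟪b, (Real.sqrt 2)⁻¹ • (p - q)⟫ =
      ⟪(Real.sqrt 2)⁻¹ • (a - b), p⟫ + ⟪(Real.sqrt 2)⁻¹ • (a + b), q⟫ := by
  simp only [inner_smul_right, real_inner_smul_left, inner_add_right, inner_sub_right,
    inner_add_left, inner_sub_left]
  ring

theorem inv_sqrt_two_smul_inv_sqrt_two_smul {E : Type*} [AddCommGroup E] [Module ℝ E] (x : E) :
    (Real.sqrt 2)⁻¹ • (Real.sqrt 2)⁻¹ • (x + x) = x := by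
  have h : (Real.sqrt 2)⁻¹ * (Real.sqrt 2)⁻¹ * 2 = 1 := by
    rw [← mul_inv, Real.mul_self_sqrt zero_le_two, inv_mul_cancel₀ two_ne_zero]
  rw [← two_smul ℝ x, smul_smul, smul_smul, h, one_smul]

/-- Selfduality of the charge lattice `Γ` of a toroidal SCFT with respect to the
signature-`(n,n)` form `Q((a,b),(a',b')) = ⟪a,a'⟫ - ⟪b,b'⟫`:
`{v : Q(v, γ) ∈ ℤ for all γ ∈ Γ} = Γ`. -/
theorem charge_lattice_selfdual {n : ℕ}
    (L : AddSubgroup (EuclideanSpace ℝ (Fin n)))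
    (hdisc : DiscreteTopology L)
    (hspan : Submodule.span ℝ (L : Set (EuclideanSpace ℝ (Fin n))) = ⊤)
    (B : EuclideanSpace ℝ (Fin n) →ₗ[ℝ] EuclideanSpace ℝ (Fin n))
    (hB : ∀ x y : EuclideanSpace ℝ (Fin n), ⟪B x, y⟫ = -⟪x, B y⟫)
    (Ldual : Set (EuclideanSpace ℝ (Fin n)))
    (hLdual : Ldual = {mu | ∀ l ∈ L, ∃ m : ℤ, ⟪mu, l⟫ = (m : ℝ)})
    (Γ : Set (EuclideanSpace ℝ (Fin n) × EuclideanSpace ℝ (Fin n)))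
    (hΓ : Γ = {γ | ∃ lam ∈ L, ∃ mu ∈ Ldual,
        γ = ((Real.sqrt 2)⁻¹ • (mu - B lam + lam),
             (Real.sqrt 2)⁻¹ • (mu - B lam - lam))}) :
    {v : EuclideanSpace ℝ (Fin n) × EuclideanSpace ℝ (Fin n) |
        ∀ γ ∈ Γ, ∃ m : ℤ, ⟪v.1, γ.1⟫ - ⟪v.2, γ.2⟫ = (m : ℝ)} = Γ := by
  have hzero : (0 : EuclideanSpace ℝ (Fin n)) ∈ Ldual := by
    rw [hLdual]
    exact fun l _ => ⟨0, by simp⟩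
  subst hΓ
  ext ⟨a, b⟩
  constructor
  · intro h
    have hpair : ∀ lam ∈ L, ∀ mu ∈ Ldual, ∃ m : ℤ,
        ⟪(Real.sqrt 2)⁻¹ • (a - b), mu - B lam⟫ + ⟪(Real.sqrt 2)⁻¹ • (a + b), lam⟫ = (m : ℝ) := by
      intro lam hlam mu hmu
      rw [← inner_sub_inner_sqrt_two_smul]
      exact h _ ⟨lam, hlam, mu, hmu, rfl⟩
    set q := (Real.sqrt 2)⁻¹ • (a - b) with hq
    set p := (Real.sqrt 2)⁻¹ • (a + b) with hp
    have hqL : q ∈ L := by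
      refine mem_of_forall_dual_inner_mem_int L hdisc hspan fun mu hmu => ?_
      simpa using hpair 0 L.zero_mem mu (by rw [hLdual]; exact hmu)
    refine ⟨q, hqL, p + B q, ?_, ?_⟩
    · rw [hLdual]
      intro lam hlam
      obtain ⟨m, hm⟩ := hpair lam hlam 0 hzero
      refine ⟨m, ?_⟩
      rw [inner_add_left, hB, ← hm, zero_sub, inner_neg_right, add_comm]
    · rw [add_sub_cancel_right, hp, hq, ← smul_add, ← smul_sub]
      rw [show a + b + (a - b) = a + a by abel, show a + b - (a - b) = b + b by abel,
        inv_sqrt_two_smul_inv_sqrt_two_smul, inv_sqrt_two_smul_inv_sqrt_two_smul]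
  · rintro ⟨lam', hlam', mu', hmu', hab⟩ _ ⟨lam, hlam, mu, hmu, rfl⟩
    obtain ⟨rfl, rfl⟩ := Prod.mk.inj hab
    rw [hLdual] at hmu hmu'
    obtain ⟨m, hm⟩ := hmu lam' hlam'
    obtain ⟨m', hm'⟩ := hmu' lam hlam
    refine ⟨m + m', ?_⟩
    rw [inner_sub_inner_sqrt_two_smul, ← smul_sub, ← smul_add]
    rw [show mu' - B lam' + lam' - (mu' - B lam' - lam') = lam' + lam' by abel,
      show mu' - B lam' + lam' + (mu' - B lam' - lam') = mu' - B lam' + (mu' - B lam') by abel,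
      inv_sqrt_two_smul_inv_sqrt_two_smul, inv_sqrt_two_smul_inv_sqrt_two_smul,
      inner_sub_right, inner_sub_left, hB, real_inner_comm mu lam', hm, hm']
    push_cast
    ring
end

section
/- Let E = ℝⁿ with its standard inner product ⟪·,·⟫, let L ⊆ E be a ℤ-lattice (a discrete additive subgroup spanning E over ℝ) with dual lattice L* := { μ ∈ E : ⟪μ, λ⟫ ∈ ℤ for all λ ∈ L }, let B : E → E be a skew-symmetric linear map, and let Γ := { (1/√2)(μ - Bλ + λ, μ - Bλ - λ) : λ ∈ L, μ ∈ L* } ⊆ E × E. Define the subspaces Y := { (x, x) : x ∈ E } and Y⁰ := { (x - Bx, -x - Bx) : x ∈ E } of E × E. Then: (i) Q vanishes identically on Y and on Y⁰ (both subspaces are null for Q); (ii) E × E = Y ⊕ Y⁰ (they are complementary); (iii) Γ ∩ Y = { (1/√2)(μ, μ) : μ ∈ L* } and Γ ∩ Y⁰ = { (1/√2)(λ - Bλ, -λ - Bλ) : λ ∈ L }. -/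
open scoped RealInnerProductSpace

/-- The standard geometric interpretation of the charge lattice `Γ` of a toroidal SCFT:
the subspaces `Y = {(x,x)}` and `Y⁰ = {(x - Bx, -x - Bx)}` are null for `Q`, complementary,
and intersect `Γ` in the lattices `(1/√2)·L*` and `(1/√2)·(I-B)L`, respectively. -/
theorem geometric_interpretation_of_charge_lattice {n : ℕ}
    (L : AddSubgroup (EuclideanSpace ℝ (Fin n)))
    (hdisc : DiscreteTopology L)
    (hspan : Submodule.span ℝ (L : Set (EuclideanSpace ℝ (Fin n))) = ⊤)
    (B : EuclideanSpace ℝ (Fin n) →ₗ[ℝ] EuclideanSpace ℝ (Fin n))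
    (hB : ∀ x y : EuclideanSpace ℝ (Fin n), ⟪B x, y⟫ = -⟪x, B y⟫)
    (Ldual : Set (EuclideanSpace ℝ (Fin n)))
    (hLdual : Ldual = {mu | ∀ l ∈ L, ∃ m : ℤ, ⟪mu, l⟫ = (m : ℝ)})
    (Γ : Set (EuclideanSpace ℝ (Fin n) × EuclideanSpace ℝ (Fin n)))
    (hΓ : Γ = {γ | ∃ lam ∈ L, ∃ mu ∈ Ldual,
        γ = ((Real.sqrt 2)⁻¹ • (mu - B lam + lam),
             (Real.sqrt 2)⁻¹ • (mu - B lam - lam))})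
    (Y Y0 : Submodule ℝ (EuclideanSpace ℝ (Fin n) × EuclideanSpace ℝ (Fin n)))
    (hY : (Y : Set (EuclideanSpace ℝ (Fin n) × EuclideanSpace ℝ (Fin n))) =
      {p | ∃ x, p = (x, x)})
    (hY0 : (Y0 : Set (EuclideanSpace ℝ (Fin n) × EuclideanSpace ℝ (Fin n))) =
      {p | ∃ x, p = (x - B x, -x - B x)}) :
    -- (i) both subspaces are null for Q
    (∀ v ∈ Y, ∀ w ∈ Y, ⟪Prod.fst v, Prod.fst w⟫ - ⟪Prod.snd v, Prod.snd w⟫ = 0) ∧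
    (∀ v ∈ Y0, ∀ w ∈ Y0, ⟪Prod.fst v, Prod.fst w⟫ - ⟪Prod.snd v, Prod.snd w⟫ = 0) ∧
    -- (ii) they are complementary
    IsCompl Y Y0 ∧
    -- (iii) the intersections with Γ
    Γ ∩ Y = {p | ∃ mu ∈ Ldual, p = ((Real.sqrt 2)⁻¹ • mu, (Real.sqrt 2)⁻¹ • mu)} ∧
    Γ ∩ Y0 = {p | ∃ lam ∈ L,
      p = ((Real.sqrt 2)⁻¹ • (lam - B lam), (Real.sqrt 2)⁻¹ • (-lam - B lam))} := by
  have mem_Y : ∀ p, p ∈ Y ↔ ∃ x, p = (x, x) := fun p => by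
    rw [← SetLike.mem_coe, hY, Set.mem_ofPred_eq]
  have mem_Y0 : ∀ p, p ∈ Y0 ↔ ∃ x, p = (x - B x, -x - B x) := fun p => by
    rw [← SetLike.mem_coe, hY0, Set.mem_ofPred_eq]
  have sqrt_two_ne : (Real.sqrt 2)⁻¹ ≠ 0 := by positivity
  have zero_mem_Ldual : (0 : EuclideanSpace ℝ (Fin n)) ∈ Ldual := by
    rw [hLdual]
    exact fun l _ => ⟨0, by simp⟩
  refine ⟨?_, ?_, ⟨?_, ?_⟩, ?_, ?_⟩
  · intro v hv w hw
    obtain ⟨x, rfl⟩ := (mem_Y v).1 hv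
    obtain ⟨y, rfl⟩ := (mem_Y w).1 hw
    exact sub_self _
  · intro v hv w hw
    obtain ⟨x, rfl⟩ := (mem_Y0 v).1 hv
    obtain ⟨y, rfl⟩ := (mem_Y0 w).1 hw
    simp only [inner_sub_left, inner_sub_right, inner_neg_left, inner_neg_right]
    linarith [hB x y]
  · rw [Submodule.disjoint_def]
    intro v hv hw
    obtain ⟨x, rfl⟩ := (mem_Y v).1 hv
    obtain ⟨y, h⟩ := (mem_Y0 _).1 hw
    obtain ⟨h₁, h₂⟩ := Prod.mk.inj h
    have hy : y = 0 := by linear_combination (norm := module) (1 / 2 : ℝ) • (h₂ - h₁)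
    simp [h₁, hy]
  · rw [codisjoint_iff, eq_top_iff]
    rintro ⟨a, b⟩ -
    set x := (1 / 2 : ℝ) • (a - b) with hx
    refine Submodule.mem_sup.2 ⟨(a - x + B x, a - x + B x), (mem_Y _).2 ⟨_, rfl⟩,
      (x - B x, -x - B x), (mem_Y0 _).2 ⟨x, rfl⟩, ?_⟩
    refine Prod.ext ?_ ?_
    · simp only [Prod.fst_add]
      abel
    · simp only [Prod.snd_add, hx]
      module
  · ext p
    simp only [hΓ, Set.mem_inter_iff, Set.mem_ofPred_eq, SetLike.mem_coe]
    constructor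
    · rintro ⟨⟨l, -, mu, hmu, rfl⟩, hp⟩
      obtain ⟨x, h⟩ := (mem_Y _).1 hp
      obtain ⟨h₁, h₂⟩ := Prod.mk.inj h
      have h₃ := smul_right_injective _ sqrt_two_ne (h₁.trans h₂.symm)
      have hl : l = 0 := by linear_combination (norm := module) (1 / 2 : ℝ) • h₃
      exact ⟨mu, hmu, by simp [hl]⟩
    · rintro ⟨mu, hmu, rfl⟩
      exact ⟨⟨0, L.zero_mem, mu, hmu, by simp⟩, (mem_Y _).2 ⟨_, rfl⟩⟩
  · ext p
    simp only [hΓ, Set.mem_inter_iff, Set.mem_ofPred_eq, SetLike.mem_coe]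
    constructor
    · rintro ⟨⟨l, hl, mu, -, rfl⟩, hp⟩
      obtain ⟨x, h⟩ := (mem_Y0 _).1 hp
      obtain ⟨h₁, h₂⟩ := Prod.mk.inj h
      have hx : x = (Real.sqrt 2)⁻¹ • l := by
        linear_combination (norm := module) (1 / 2 : ℝ) • (h₂ - h₁)
      rw [hx, map_smul] at h₁
      have hmu : mu = 0 := by
        refine smul_right_injective _ sqrt_two_ne ?_
        dsimp only
        linear_combination (norm := module) h₁
      refine ⟨l, hl, ?_⟩
      subst hmu
      refine Prod.ext ?_ ?_ <;> dsimp only <;> module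
    · rintro ⟨l, hl, rfl⟩
      refine ⟨⟨l, hl, 0, zero_mem_Ldual, ?_⟩, (mem_Y0 _).2 ⟨(Real.sqrt 2)⁻¹ • l, ?_⟩⟩
      · refine Prod.ext ?_ ?_ <;> dsimp only <;> module
      · rw [map_smul]
        refine Prod.ext ?_ ?_ <;> dsimp only <;> module
end
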